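/- Let G be a finite group and suppose every maximal subgroup of G is either supersolvable or has index in G equal to a prime or the square of a prime. If G is nonsolvable, then G has both a maximal subgroup of prime or squared-prime index and a supersolvable maximal subgroup. -/

import Mathlib

/-- A group is supersolvable if it has a chain of subgroups from `⊥` to `⊤`,
each normal in the whole group, with each successive factor cyclic
(i.e. each term is generated by the previous term together with one element). -/
def IsSupersolvable (G : Type*) [Group G] : Prop :=
  ∃ (n : ℕ) (s : Fin (n + 1) → Subgroup G),
    s 0 = ⊥ ∧ s (Fin.last n) = ⊤ ∧ (∀ i, (s i).Normal) ∧
    ∀ i : Fin n, ∃ x : G, s i.succ = s i.castSucc ⊔ Subgroup.closure {x}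

open Subgroup
open scoped commutatorElement

theorem isSolvable_of_normal_of_quotient {G : Type*} [Group G] (N : Subgroup G) [N.Normal]
    (hN : Group.IsSolvable N) (hQ : Group.IsSolvable (G ⧸ N)) : Group.IsSolvable G :=
  Group.isSolvable_of_ker_le_range N.subtype (QuotientGroup.mk' N) (by simp)

theorem IsPGroup.isSolvable {G : Type*} [Group G] [Finite G] {p : ℕ} [Fact p.Prime]
    (h : IsPGroup p G) : Group.IsSolvable G :=
  have := h.isNilpotent
  inferInstance

theorem Equiv.Perm.isSolvable_of_card_eq_four {α : Type*} (hα : Nat.card α = 4) :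
    Group.IsSolvable (Equiv.Perm α) := by
  classical
  have : Finite α := Nat.finite_of_card_ne_zero (by omega)
  have : Fintype α := Fintype.ofFinite α
  have hK := alternatingGroup.normal_kleinFour hα
  have hK4 := alternatingGroup.kleinFour_isKleinFour hα
  have hKs : Group.IsSolvable (alternatingGroup.kleinFour α) :=
    Group.isSolvable_of_comm (mul_comm_of_exponent_two hK4.exponent_two)
  have hc : Nat.card (alternatingGroup α ⧸ alternatingGroup.kleinFour α) = 3 := by
    have := Subgroup.card_eq_card_quotient_mul_card_subgroup (alternatingGroup.kleinFour α)
    rw [alternatingGroup.card_of_card_eq_four hα,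
      alternatingGroup.kleinFour_card_of_card_eq_four hα] at this
    omega
  have : Fact (Nat.Prime 3) := ⟨Nat.prime_three⟩
  have hQ : Group.IsSolvable (alternatingGroup α ⧸ alternatingGroup.kleinFour α) :=
    (IsPGroup.of_card (p := 3) (n := 1) (by simpa using hc)).isSolvable
  have hA : Group.IsSolvable (alternatingGroup α) := isSolvable_of_normal_of_quotient _ hKs hQ
  refine Group.isSolvable_of_ker_le_range (alternatingGroup α).subtype Equiv.Perm.sign ?_
  rw [Subgroup.range_subtype, alternatingGroup_eq_sign_ker]

theorem Sylow.index_modEq_one_of_normalizer_le {G : Type*} [Group G] [Finite G] {p : ℕ}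
    [Fact p.Prime] (P : Sylow p G) (H : Subgroup G) (hH : normalizer (P : Set G) ≤ H) :
    H.index ≡ 1 [MOD p] := by
  have hP : (P : Subgroup G) ≤ H := le_normalizer.trans hH
  have h1 := card_sylow_modEq_one p G
  have h2 := card_sylow_modEq_one p H
  rw [P.card_eq_index_normalizer] at h1
  rw [(P.subtype hP).card_eq_index_normalizer] at h2
  have h3 : normalizer ((P.subtype hP : Sylow p H) : Set H) =
      (normalizer (P : Set G)).subgroupOf H := by
    ext x
    simp only [mem_subgroupOf]
    constructor
    · intro hx g
      by_cases hg : g ∈ H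
      · exact hx ⟨g, hg⟩
      · refine ⟨fun h => absurd (hP h) hg, fun h => absurd ?_ hg⟩
        have := H.mul_mem (H.mul_mem (H.inv_mem x.2) (hP h)) x.2
        simpa [mul_assoc] using this
    · intro hx g
      exact hx g
  rw [← relIndex_mul_index hH, relIndex, ← h3] at h1
  calc H.index = 1 * H.index := (one_mul _).symm
    _ ≡ _ * H.index [MOD p] := h2.symm.mul_right _
    _ ≡ 1 [MOD p] := h1

theorem Subgroup.index_eq_relIndex_of_sup_eq_top {G : Type*} [Group G] [Finite G] {N M : Subgroup G}
    [N.Normal] (h : N ⊔ M = ⊤) : M.index = M.relIndex N := by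
  have h1 := relIndex_mul_index (inf_le_left : N ⊓ M ≤ N)
  rw [← relIndex_mul_index (inf_le_right : N ⊓ M ≤ M), inf_relIndex_left, inf_relIndex_right,
    ← relIndex_sup_left M N, h, relIndex_top_right, mul_comm] at h1
  exact (Nat.eq_of_mul_eq_mul_left (Nat.pos_of_ne_zero N.index_ne_zero_of_finite) h1).symm

theorem exists_minimal_normal (G : Type*) [Group G] [Finite G] [Nontrivial G] :
    ∃ N : Subgroup G, N.Normal ∧ N ≠ ⊥ ∧ ∀ K : Subgroup G, K.Normal → K ≤ N → K ≠ ⊥ → K = N := by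
  obtain ⟨N, hN⟩ := (Set.toFinite {N : Subgroup G | N.Normal ∧ N ≠ ⊥}).exists_minimal
    ⟨⊤, inferInstance, top_ne_bot⟩
  exact ⟨N, hN.1.1, hN.1.2, fun K hK hle hb => hle.antisymm (hN.2 ⟨hK, hb⟩ hle)⟩

theorem Nat.Prime.eq_four_of_modEq_one {p q m : ℕ} (hp : p.Prime) (hq : q.Prime) (hle : q ≤ p)
    (hm : m = q ∨ m = q ^ 2) (h : m ≡ 1 [MOD p]) : m = 4 := by
  have h1 : p ∣ m - 1 :=
    (Nat.modEq_iff_dvd' (by rcases hm with rfl | rfl; exacts [hq.pos, pow_pos hq.pos 2])).1 h.symm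
  have hq2 := hq.two_le
  rcases hm with rfl | rfl
  · have := Nat.le_of_dvd (by omega) h1
    omega
  · have h2 : q ^ 2 - 1 = (q + 1) * (q - 1) := by simpa using Nat.sq_sub_sq q 1
    rw [h2, hp.dvd_mul] at h1
    rcases h1 with h1 | h1
    · have h3 := Nat.le_of_dvd (by omega) h1
      rcases hle.eq_or_lt with rfl | h4
      · have : q ∣ 1 := (Nat.dvd_add_right dvd_rfl).1 h1
        simp at this
        omega
      · obtain rfl : p = q + 1 := by omega
        rcases hq.eq_two_or_odd' with rfl | h5
        · rfl
        · have := (hp.eq_two_or_odd').resolve_left (by omega)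
          grind
    · have := Nat.le_of_dvd (by omega) h1
      omega

theorem isSolvable_of_index_prime_or_sq {G : Type*} [Group G] [Finite G]
    (h : ∀ M : Subgroup G, IsCoatom M → ∃ q : ℕ, q.Prime ∧ (M.index = q ∨ M.index = q ^ 2)) :
    Group.IsSolvable G := by
  induction hn : Nat.card G using Nat.strong_induction_on generalizing G with | _ n ih
  subst hn
  rcases subsingleton_or_nontrivial G with hG | hG
  · infer_instance
  obtain ⟨N, hN, hNb, hmin⟩ := exists_minimal_normal G
  have hNs : Group.IsSolvable N := by
    have hN1 : Nat.card N ≠ 1 := fun h => hNb (card_eq_one.1 h)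
    have hne : (Nat.card N).primeFactors.Nonempty := by
      rw [Nat.nonempty_primeFactors]
      have := Nat.card_pos (α := N)
      omega
    obtain ⟨p, hpm, hpmax⟩ := (Nat.card N).primeFactors.exists_max_image id hne
    have hp := Nat.prime_of_mem_primeFactors hpm
    have : Fact p.Prime := ⟨hp⟩
    let P : Sylow p N := default
    by_cases hnorm : normalizer ((P.map N.subtype : Subgroup G) : Set G) = ⊤
    · have hnormal : (P.map N.subtype).Normal := normalizer_eq_top_iff.1 hnorm
      have hPb : P.map N.subtype ≠ ⊥ := by
        rw [Ne, (map_eq_bot_iff_of_injective _ N.subtype_injective)]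
        exact P.ne_bot_of_dvd_card (Nat.dvd_of_mem_primeFactors hpm)
      rw [← hmin _ hnormal (map_subtype_le _) hPb]
      exact (P.2.map _).isSolvable
    · obtain ⟨M, hM, hle⟩ := (eq_top_or_exists_le_coatom _).resolve_left hnorm
      have hsup : N ⊔ M = ⊤ := by
        rw [eq_top_iff, ← P.normalizer_sup_eq_top, sup_comm]
        exact sup_le_sup_left hle _
      have hidx : M.index = M.relIndex N := index_eq_relIndex_of_sup_eq_top hsup
      have hmod : M.index ≡ 1 [MOD p] := by
        rw [hidx]
        refine P.index_modEq_one_of_normalizer_le _ fun x hx => hle ?_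
        have := le_normalizer_map (H := (P : Subgroup N)) N.subtype (mem_map_of_mem N.subtype hx)
        simpa using this
      obtain ⟨q, hq, hqi⟩ := h M hM
      have hqN : q ∣ Nat.card N := by
        refine dvd_trans ?_ (hidx ▸ relIndex_dvd_card M N)
        rcases hqi with h | h <;> rw [h]
        exact dvd_pow_self _ two_ne_zero
      have hqp : q ≤ p := hpmax q (Nat.mem_primeFactors.2 ⟨hq, hqN, Nat.card_pos.ne'⟩)
      have h4 : Nat.card (G ⧸ M) = 4 := hp.eq_four_of_modEq_one hq hqp hqi hmod
      have := Equiv.Perm.isSolvable_of_card_eq_four h4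
      refine Group.isSolvable_of_isSolvable_injective
        (f := (MulAction.toPermHom G (G ⧸ M)).comp N.subtype) ?_
      rw [← MonoidHom.ker_eq_bot_iff, ← MonoidHom.comap_ker, ← normalCore_eq_ker]
      change M.normalCore.subgroupOf N = ⊥
      rw [subgroupOf_eq_bot, disjoint_iff]
      by_contra hb
      have := hmin _ inferInstance inf_le_right hb
      have hNM : N ≤ M := (inf_eq_right.1 this).trans M.normalCore_le
      rw [sup_eq_right.2 hNM] at hsup
      exact hM.1 hsup
  refine isSolvable_of_normal_of_quotient N hNs (ih _ ?_ (fun M hM => ?_) rfl)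
  · rw [card_eq_card_quotient_mul_card_subgroup N]
    exact lt_mul_of_one_lt_right Nat.card_pos ((one_lt_card_iff_ne_bot N).2 hNb)
  · rw [← index_comap_of_surjective M (QuotientGroup.mk'_surjective N)]
    exact h _ (isCoatom_comap_of_surjective (QuotientGroup.mk'_surjective N) hM)

namespace IsSupersolvable

theorem of_surjective {G H : Type*} [Group G] [Group H] {f : G →* H}
    (hf : Function.Surjective f) (h : IsSupersolvable G) : IsSupersolvable H := by
  obtain ⟨n, s, h0, h1, hn, hs⟩ := h
  refine ⟨n, fun i => (s i).map f, by simp [h0], ?_, fun i => (hn i).map f hf, fun i => ?_⟩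
  · simp only [h1]
    exact map_top_of_surjective f hf
  · obtain ⟨x, hx⟩ := hs i
    exact ⟨f x, by simp only [hx, Subgroup.map_sup, MonoidHom.map_closure, Set.image_singleton]⟩

theorem exists_normal_zpowers {G : Type*} [Group G] [Nontrivial G] (h : IsSupersolvable G) :
    ∃ x : G, x ≠ 1 ∧ (zpowers x).Normal := by
  obtain ⟨n, s, h0, h1, hn, hs⟩ := h
  by_contra! hx
  have hbot : ∀ i, s i = ⊥ := by
    intro i
    induction i using Fin.induction with
    | zero => exact h0
    | succ i ih =>
      obtain ⟨x, hxi⟩ := hs i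
      rw [ih, bot_sup_eq, ← zpowers_eq_closure] at hxi
      rw [hxi, zpowers_eq_bot]
      by_contra hx1
      exact hx x hx1 (hxi ▸ hn _)
  exact bot_ne_top ((hbot _).symm.trans h1)

theorem exists_normal_prime_card {G : Type*} [Group G] [Finite G] [Nontrivial G]
    (h : IsSupersolvable G) :
    ∃ A : Subgroup G, A.Normal ∧ (Nat.card A).Prime := by
  obtain ⟨x, hx, hn⟩ := h.exists_normal_zpowers
  have hx1 : orderOf x ≠ 1 := mt orderOf_eq_one_iff.1 hx
  set q := (orderOf x).minFac with hq
  have hqp : q.Prime := Nat.minFac_prime hx1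
  have hd : q ∣ orderOf x := Nat.minFac_dvd _
  refine ⟨zpowers (x ^ (orderOf x / q)), ⟨fun y hy g => ?_⟩, ?_⟩
  · obtain ⟨k, rfl⟩ := hy
    obtain ⟨m, hm⟩ := hn.conj_mem x (mem_zpowers x) g
    refine ⟨m * k, ?_⟩
    simp only at hm ⊢
    rw [← conj_zpow, ← conj_pow, ← hm, ← zpow_natCast, ← zpow_natCast]
    simp only [← zpow_mul]
    exact congrArg (x ^ ·) (by ring)
  · rw [Nat.card_zpowers, orderOf_pow_of_dvd (Nat.div_pos (Nat.le_of_dvd (orderOf_pos x) hd)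
      hqp.pos).ne' (Nat.div_dvd_of_dvd hd), Nat.div_div_self hd (orderOf_pos x).ne']
    exact hqp

theorem isSolvable {G : Type*} [Group G] [Finite G] (h : IsSupersolvable G) :
    Group.IsSolvable G := by
  induction hn : Nat.card G using Nat.strong_induction_on generalizing G with | _ n ih
  subst hn
  rcases subsingleton_or_nontrivial G with hG | hG
  · infer_instance
  obtain ⟨A, hA, hp⟩ := h.exists_normal_prime_card
  have : Fact (Nat.card A).Prime := ⟨hp⟩
  refine isSolvable_of_normal_of_quotient A (IsPGroup.card (G := A)).isSolvable
    (ih _ ?_ (h.of_surjective (QuotientGroup.mk'_surjective A)) rfl)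
  rw [card_eq_card_quotient_mul_card_subgroup A]
  exact lt_mul_of_one_lt_right Nat.card_pos hp.one_lt

end IsSupersolvable

/-- A group is `p`-nilpotent if it has a normal subgroup without elements of order `p`
whose quotient is a `p`-group. -/
def IsPNilpotent (p : ℕ) (G : Type*) [Group G] : Prop :=
  ∃ K : Subgroup G, K.Normal ∧ (∀ k ∈ K, k ^ p = 1 → k = 1) ∧ ∀ g : G, ∃ n : ℕ, g ^ p ^ n ∈ K

theorem eq_one_of_pow_prime_pow_eq_one {G : Type*} [Group G] {p : ℕ} {K : Subgroup G}
    (hK : ∀ k ∈ K, k ^ p = 1 → k = 1) {n : ℕ} {x : G} (hx : x ∈ K) (h : x ^ p ^ n = 1) :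
    x = 1 := by
  induction n with
  | zero => simpa using h
  | succ n ih => exact ih (hK _ (K.pow_mem hx _) (by rwa [← pow_mul, ← pow_succ]))

/-- A normal subgroup of order the smallest prime divisor of `|G|` is central. -/
theorem commute_of_mem_normal_of_card_minimal {G : Type*} [Group G] [Finite G] {A : Subgroup G}
    [A.Normal] {p : ℕ} (hp : p.Prime) (hA : Nat.card A = p)
    (hmin : ∀ q : ℕ, q.Prime → q ∣ Nat.card G → p ≤ q) {a : G} (ha : a ∈ A) (g : G) :
    Commute g a := by
  have : Fact p.Prime := ⟨hp⟩
  have hcyc : IsCyclic A := isCyclic_of_prime_card hA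
  have hr : Nat.card (MulAut.conjNormal (H := A)).range = 1 := by
    by_contra hne
    obtain ⟨q, hq, hqd⟩ := Nat.exists_prime_and_dvd hne
    have h1 := hmin q hq (hqd.trans (card_range_dvd _))
    have h2 := hqd.trans (card_subgroup_dvd_card _)
    rw [IsCyclic.card_mulAut, hA, Nat.totient_prime hp] at h2
    have := Nat.le_of_dvd (by have := hp.two_le; omega) h2
    have := hp.two_le
    omega
  have h1 : MulAut.conjNormal (H := A) g = 1 := by
    have : MulAut.conjNormal (H := A) g ∈ (MulAut.conjNormal (H := A)).range := ⟨g, rfl⟩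
    rwa [card_eq_one.1 hr, mem_bot] at this
  have h2 := congrArg Subtype.val (DFunLike.congr_fun h1 ⟨a, ha⟩)
  simp only [MulAut.conjNormal_apply, MulAut.one_apply] at h2
  exact mul_inv_eq_iff_eq_mul.1 h2

namespace IsPNilpotent

variable {p : ℕ} {G : Type*} [Group G]

theorem of_injective {H : Type*} [Group H] {f : H →* G} (hf : Function.Injective f)
    (h : IsPNilpotent p G) : IsPNilpotent p H := by
  obtain ⟨K, hK, h1, h2⟩ := h
  refine ⟨K.comap f, hK.comap f, fun k hk hkp => hf ?_, fun g => ?_⟩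
  · rw [map_one]
    exact h1 _ hk (by rw [← map_pow, hkp, map_one])
  · obtain ⟨n, hn⟩ := h2 (f g)
    exact ⟨n, by simpa using hn⟩

theorem mono {H K : Subgroup G} (hle : H ≤ K) (h : IsPNilpotent p K) : IsPNilpotent p H :=
  h.of_injective (inclusion_injective hle)

theorem of_quotient_of_pow_eq_one (A : Subgroup G) [A.Normal]
    (hA : ∀ a ∈ A, a ^ p = 1 → a = 1) (h : IsPNilpotent p (G ⧸ A)) : IsPNilpotent p G := by
  obtain ⟨K, hK, h1, h2⟩ := h
  refine ⟨K.comap (QuotientGroup.mk' A), hK.comap _, fun k hk hkp => hA k ?_ hkp, fun g => ?_⟩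
  · rw [← QuotientGroup.eq_one_iff]
    exact h1 _ hk (by rw [← QuotientGroup.mk_pow, hkp]; rfl)
  · obtain ⟨n, hn⟩ := h2 g
    exact ⟨n, by simpa using hn⟩

theorem of_quotient_central [Finite G] (hp : p.Prime) (A : Subgroup G) [A.Normal]
    (hc : ∀ a ∈ A, ∀ g : G, Commute g a) (hA : Nat.card A = p) (h : IsPNilpotent p (G ⧸ A)) :
    IsPNilpotent p G := by
  have : Fact p.Prime := ⟨hp⟩
  obtain ⟨K, hK, h1, h2⟩ := h
  set L := K.comap (QuotientGroup.mk' A) with hL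
  have hLn : L.Normal := hK.comap _
  have hAL : A ≤ L := fun a ha => by
    rw [hL, mem_comap, QuotientGroup.mk'_apply, (QuotientGroup.eq_one_iff a).2 ha]
    exact K.one_mem
  have hAp : ∀ a ∈ A, a ^ p = 1 := fun a ha => by
    simpa [hA] using congrArg Subtype.val (pow_card_eq_one' (x := (⟨a, ha⟩ : A)))
  have hcop : (Nat.card (A.subgroupOf L)).Coprime (A.subgroupOf L).index := by
    rw [Nat.card_congr (subgroupOfEquivOfLe hAL).toEquiv, hA, hp.coprime_iff_not_dvd]
    intro hd
    obtain ⟨x, hx⟩ := exists_prime_orderOf_dvd_card' (G := L ⧸ A.subgroupOf L) p hd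
    obtain ⟨l, rfl⟩ := QuotientGroup.mk_surjective x
    have hlp := pow_orderOf_eq_one (l : L ⧸ A.subgroupOf L)
    rw [hx, ← QuotientGroup.mk_pow, QuotientGroup.eq_one_iff, mem_subgroupOf] at hlp
    have hl : ((l : G) : G ⧸ A) = 1 := by
      refine h1 _ l.2 ?_
      rw [← QuotientGroup.mk_pow, QuotientGroup.eq_one_iff]
      exact hlp
    rw [QuotientGroup.eq_one_iff] at hl
    rw [(QuotientGroup.eq_one_iff l).2 (mem_subgroupOf.2 hl), orderOf_one] at hx
    exact hp.one_lt.ne hx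
  obtain ⟨C, hC⟩ := exists_right_complement'_of_coprime hcop
  have hm : p.Coprime (Nat.card C) := by
    rwa [hC.symm.index_eq_card, Nat.card_congr (subgroupOfEquivOfLe hAL).toEquiv, hA] at hcop
  have hdec : ∀ l ∈ L, ∃ a ∈ A, ∃ c ∈ C.map L.subtype, l = a * c := fun l hl => by
    obtain ⟨⟨a, c⟩, hac⟩ := hC.2 ⟨l, hl⟩
    exact ⟨a.1, a.2, c.1, mem_map_of_mem _ c.2, congrArg Subtype.val hac.symm⟩
  have hCm : ∀ c ∈ C.map L.subtype, c ^ Nat.card C = 1 := by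
    rintro _ ⟨c, hc, rfl⟩
    exact congrArg (fun x : C => ((x : L) : G)) (pow_card_eq_one' (x := (⟨c, hc⟩ : C)))
  have hCL : C.map L.subtype ≤ L := map_subtype_le C
  have hmem : ∀ l ∈ L, l ^ Nat.card C = 1 → l ∈ C.map L.subtype := by
    intro l hl hlm
    obtain ⟨a, ha, c, hcc, rfl⟩ := hdec l hl
    rw [(hc a ha c).symm.mul_pow, hCm c hcc, mul_one] at hlm
    have : orderOf a = 1 :=
      Nat.eq_one_of_dvd_coprimes hm (orderOf_dvd_of_pow_eq_one (hAp a ha))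
        (orderOf_dvd_of_pow_eq_one hlm)
    rwa [orderOf_eq_one_iff.1 this, one_mul]
  refine ⟨C.map L.subtype, ⟨fun c hcc g => ?_⟩, fun c hcc hcp => ?_, fun g => ?_⟩
  · exact hmem _ (hLn.conj_mem c (hCL hcc) g) (by rw [conj_pow, hCm c hcc]; simp)
  · exact orderOf_eq_one_iff.1 (Nat.eq_one_of_dvd_coprimes hm (orderOf_dvd_of_pow_eq_one hcp)
      (orderOf_dvd_of_pow_eq_one (hCm c hcc)))
  · obtain ⟨n, hn⟩ := h2 g
    obtain ⟨a, ha, c, hcc, hg⟩ := hdec (g ^ p ^ n) (by simpa [hL] using hn)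
    refine ⟨n + 1, ?_⟩
    rw [pow_succ, pow_mul, hg, (hc a ha c).symm.mul_pow, hAp a ha, one_mul]
    exact Subgroup.pow_mem _ hcc _

end IsPNilpotent

theorem IsSupersolvable.isPNilpotent {G : Type*} [Group G] [Finite G] {p : ℕ} (hp : p.Prime)
    (hmin : ∀ q : ℕ, q.Prime → q ∣ Nat.card G → p ≤ q) (h : IsSupersolvable G) :
    IsPNilpotent p G := by
  induction hn : Nat.card G using Nat.strong_induction_on generalizing G with | _ n ih
  subst hn
  rcases subsingleton_or_nontrivial G with hG | hG
  · exact ⟨⊤, inferInstance, fun _ _ _ => Subsingleton.elim _ _, fun _ => ⟨0, mem_top _⟩⟩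
  obtain ⟨A, hA, hq⟩ := h.exists_normal_prime_card
  have hcard := card_eq_card_quotient_mul_card_subgroup A
  have hQ : IsPNilpotent p (G ⧸ A) := by
    refine ih _ ?_ (fun q hq hd => hmin q hq (hd.trans (card_quotient_dvd_card A)))
      (h.of_surjective (QuotientGroup.mk'_surjective A)) rfl
    rw [hcard]
    exact lt_mul_of_one_lt_right Nat.card_pos hq.one_lt
  by_cases hAp : Nat.card A = p
  · exact .of_quotient_central hp A
      (fun a ha g => commute_of_mem_normal_of_card_minimal hp hAp hmin ha g) hAp hQ
  · refine .of_quotient_of_pow_eq_one A (fun a ha hap => ?_) hQ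
    exact orderOf_eq_one_iff.1 (Nat.eq_one_of_dvd_coprimes ((Nat.coprime_primes hq hp).2 hAp)
      (A.orderOf_dvd_natCard ha) (orderOf_dvd_of_pow_eq_one hap))

namespace IsPNilpotent

variable {p : ℕ} [Fact p.Prime] {G : Type*} [Group G] [Finite G]

theorem exists_mul_eq (h : IsPNilpotent p G) (S : Sylow p G) {D : Subgroup G} [D.Normal]
    (hD : IsPGroup p D) (g : G) : ∃ u ∈ S, ∃ k : G, (∀ d ∈ D, Commute k d) ∧ u * k = g := by
  obtain ⟨K, hK, h1, h2⟩ := h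
  have hdisj : Disjoint K D := by
    rw [disjoint_def]
    intro x hxK hxD
    obtain ⟨n, hn⟩ := isPGroup_iff_pow_pow_eq_one.1 hD ⟨x, hxD⟩
    exact eq_one_of_pow_prime_pow_eq_one h1 hxK (congrArg Subtype.val hn)
  have hq : IsPGroup p (G ⧸ K) := by
    rw [isPGroup_iff_pow_pow_eq_one]
    intro x
    obtain ⟨g, rfl⟩ := QuotientGroup.mk_surjective x
    obtain ⟨n, hn⟩ := h2 g
    exact ⟨n, by rwa [← QuotientGroup.mk_pow, QuotientGroup.eq_one_iff]⟩
  obtain ⟨n, hn⟩ := IsPGroup.iff_card.1 hq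
  have hsup : (S : Subgroup G) ⊔ K = ⊤ := by
    rw [← index_eq_one]
    refine Nat.eq_one_of_dvd_coprimes (Nat.Coprime.pow_left n
      (((Fact.out : p.Prime).coprime_iff_not_dvd).2 S.not_dvd_index)) ?_
      (index_dvd_of_le le_sup_left)
    rw [← hn]
    exact index_dvd_of_le le_sup_right
  have hg : g ∈ ((S : Subgroup G) ⊔ K : Subgroup G) := hsup ▸ mem_top g
  obtain ⟨u, hu, k, hk, rfl⟩ := mem_sup_of_normal_right.1 hg
  exact ⟨u, hu, k, fun d hd => commute_of_normal_of_disjoint K D hK inferInstance hdisj k d hk hd,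
    rfl⟩

theorem exists_smul_eq (h : IsPNilpotent p G) (S T : Sylow p G) {D : Subgroup G} [D.Normal]
    (hD : IsPGroup p D) : ∃ k : G, (∀ d ∈ D, Commute k d) ∧ k • T = S := by
  obtain ⟨g, hg⟩ := MulAction.exists_smul_eq G T S
  obtain ⟨u, hu, k, hk, rfl⟩ := h.exists_mul_eq S hD g
  refine ⟨k, hk, ?_⟩
  rw [mul_smul, ← eq_inv_smul_iff] at hg
  rw [hg, Sylow.smul_eq_iff_mem_normalizer]
  exact inv_mem (le_normalizer hu)

end IsPNilpotent

theorem IsPGroup.lt_inf_normalizer {p : ℕ} [Fact p.Prime] {G : Type*} [Group G] [Finite G]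
    {P D : Subgroup G} (hP : IsPGroup p P) (h : D < P) : D < P ⊓ normalizer (D : Set G) := by
  refine lt_of_le_of_ne (le_inf h.le le_normalizer) fun heq => ?_
  have := hP.isNilpotent
  have hlt := Group.normalizerCondition_of_isNilpotent (D.subgroupOf P)
    (lt_top_iff_ne_top.2 fun ht => h.not_ge (subgroupOf_eq_top.1 ht))
  rw [← subgroupOf_normalizer_eq h.le] at hlt
  exact hlt.not_ge fun x hx => heq.ge ⟨x.2, hx⟩

namespace Sylow

theorem inf_lt_left {p : ℕ} {G : Type*} [Group G] {P Q : Sylow p G} (h : P ≠ Q) : (P ⊓ Q : Subgroup G) < P := by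
  refine lt_of_le_of_ne inf_le_left fun heq => h ?_
  exact (Sylow.ext (P.3 Q.2 (inf_eq_left.1 heq))).symm

theorem mem_smul_of_commute {p : ℕ} {G : Type*} [Group G] {c d : G} {P : Sylow p G} (hd : d ∈ P) (h : Commute c d) :
    d ∈ c • P := by
  have : c * d * c⁻¹ = d := by rw [h.eq, mul_inv_cancel_right]
  rw [← this]
  exact smul_mem_pointwise_smul d (MulAut.conj c) (P : Subgroup G) hd

variable {p : ℕ} [Fact p.Prime] {G : Type*} [Group G] [Finite G]

/-- If all normalizers of nontrivial `p`-subgroups are `p`-nilpotent, then any two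
Sylow `p`-subgroups are conjugate under the centralizer of their intersection. -/
theorem exists_commute_smul_eq
    (hloc : ∀ D : Subgroup G, IsPGroup p D → D ≠ ⊥ → IsPNilpotent p (normalizer (D : Set G)))
    (P Q : Sylow p G) : ∃ c : G, (∀ d ∈ (P ⊓ Q : Subgroup G), Commute c d) ∧ c • Q = P := by
  induction hD : (P ⊓ Q : Subgroup G) using WellFoundedGT.induction generalizing P Q with
  | _ D ih
  rcases eq_or_ne P Q with rfl | hne
  · exact ⟨1, fun d _ => Commute.one_left d, one_smul _ _⟩
  rcases eq_or_ne D ⊥ with rfl | hDb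
  · obtain ⟨c, hc⟩ := MulAction.exists_smul_eq G Q P
    exact ⟨c, fun d hd => (mem_bot.1 hd) ▸ Commute.one_right c, hc⟩
  have hDP : D < P := hD ▸ inf_lt_left hne
  have hDQ : D < Q := by rw [← hD, inf_comm]; exact inf_lt_left hne.symm
  have hDp : IsPGroup p D := P.2.to_le hDP.le
  set N := normalizer (D : Set G) with hN
  have hDN : D ≤ N := le_normalizer
  have hN' : (D.subgroupOf N).Normal := normal_in_normalizer
  have hPN := P.2.lt_inf_normalizer hDP
  have hQN := Q.2.lt_inf_normalizer hDQ
  obtain ⟨S, hS⟩ := (P.2.comap_subtype (K := N)).exists_le_sylow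
  obtain ⟨T, hT⟩ := (Q.2.comap_subtype (K := N)).exists_le_sylow
  obtain ⟨k, hk, hkT⟩ := (hloc D hDp hDb).exists_smul_eq S T (D := D.subgroupOf N)
    hDp.comap_subtype
  have hkD : ∀ d ∈ D, Commute (k : G) d := fun d hd =>
    congrArg Subtype.val (hk ⟨d, hDN hd⟩ hd)
  obtain ⟨R, hR⟩ := (S.2.map N.subtype).exists_le_sylow
  have hPR : D < (P ⊓ R : Subgroup G) := hPN.trans_le <| le_inf inf_le_left fun x hx =>
    hR (mem_map_of_mem N.subtype (hS (x := ⟨x, hx.2⟩) hx.1))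
  have hDkQ : D ≤ ((k : G) • Q : Sylow p G) := fun d hd =>
    mem_smul_of_commute (hDQ.le hd) (hkD d hd)
  have hQR : D < (R ⊓ ((k : G) • Q : Sylow p G) : Subgroup G) := by
    refine lt_of_le_of_ne (le_inf (hPR.le.trans inf_le_right) hDkQ) fun heq => ?_
    refine hQN.not_ge fun y hy => ?_
    have h1 : (k : G) * y * (k : G)⁻¹ ∈ D := by
      refine heq.ge ?_
      refine ⟨hR ?_, smul_mem_pointwise_smul y (MulAut.conj (k : G)) (Q : Subgroup G) hy.1⟩
      have h2 : k * ⟨y, hy.2⟩ * k⁻¹ ∈ (k • T : Sylow p N) :=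
        smul_mem_pointwise_smul _ (MulAut.conj k) (T : Subgroup N) (hT (x := ⟨y, hy.2⟩) hy.1)
      rw [hkT] at h2
      exact mem_map_of_mem N.subtype h2
    exact (mem_normalizer_iff.1 k.2 y).2 h1
  obtain ⟨c₁, hc₁, hcR⟩ := ih _ hPR P R rfl
  obtain ⟨c₂, hc₂, hcQ⟩ := ih _ hQR R ((k : G) • Q) rfl
  refine ⟨c₁ * c₂ * k, fun d hd => ((hc₁ d (hPR.le hd)).mul_left (hc₂ d (hQR.le hd))).mul_left
    (hkD d hd), ?_⟩
  rw [mul_smul, mul_smul, hcQ, hcR]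

theorem focalSubgroup_le_commutator_self (P : Sylow p G)
    (hloc : ∀ D : Subgroup G, IsPGroup p D → D ≠ ⊥ → IsPNilpotent p (normalizer (D : Set G)))
    (hP : (P : Subgroup G) ≠ ⊥) :
    (P : Subgroup G).focalSubgroup ≤ ⁅(P : Subgroup G), (P : Subgroup G)⁆ := by
  rw [focalSubgroup_def, closure_le]
  rintro _ ⟨hxu, x, hx, u, rfl⟩
  have hy : u * x * u⁻¹ ∈ P := by
    have := P.mul_mem (P.inv_mem hxu) hx
    rwa [commutatorElement_def, show (x * u * x⁻¹ * u⁻¹)⁻¹ * x = u * x * u⁻¹ by group] at this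
  obtain ⟨c, hc, hcP⟩ := exists_commute_smul_eq hloc P (u • P)
  have hcy : Commute c (u * x * u⁻¹) :=
    hc _ ⟨hy, smul_mem_pointwise_smul x (MulAut.conj u) (P : Subgroup G) hx⟩
  rw [← mul_smul, smul_eq_iff_mem_normalizer] at hcP
  have hle : (P : Subgroup G) ≤ normalizer ((P : Subgroup G) : Set G) := le_normalizer
  have hnorm : ((P : Subgroup G).subgroupOf (normalizer ((P : Subgroup G) : Set G))).Normal :=
    normal_in_normalizer
  obtain ⟨v, hv, k, hk, hvk⟩ := (hloc P P.2 hP).exists_mul_eq (P.subtype hle)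
    (D := (P : Subgroup G).subgroupOf (normalizer ((P : Subgroup G) : Set G)))
    P.2.comap_subtype ⟨c * u, hcP⟩
  have hkx : Commute (k : G) x := congrArg Subtype.val (hk ⟨x, hle hx⟩ hx)
  have hvk' : (v : G) * k = c * u := congrArg Subtype.val hvk
  have h1 : u * x * u⁻¹ = v * x * (v : G)⁻¹ := by
    calc u * x * u⁻¹ = c * (u * x * u⁻¹) * c⁻¹ := by rw [hcy.eq, mul_inv_cancel_right]
      _ = (c * u) * x * (c * u)⁻¹ := by group
      _ = v * (k * x) * (k : G)⁻¹ * (v : G)⁻¹ := by rw [← hvk']; group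
      _ = v * x * (v : G)⁻¹ := by rw [hkx.eq]; group
  have h2 : ⁅x, u⁆ = ⁅x, (v : G)⁆ := by
    calc ⁅x, u⁆ = x * (u * x * u⁻¹)⁻¹ := by rw [commutatorElement_def]; group
      _ = ⁅x, (v : G)⁆ := by rw [h1, commutatorElement_def]; group
  rw [h2]
  exact commutator_mem_commutator hx hv

theorem commutator_ne_top_of_isPNilpotent_normalizer (P : Sylow p G)
    (hloc : ∀ D : Subgroup G, IsPGroup p D → D ≠ ⊥ → IsPNilpotent p (normalizer (D : Set G)))
    (hP : (P : Subgroup G) ≠ ⊥) : commutator G ≠ ⊤ := by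
  intro htop
  have h1 : (P : Subgroup G) ≤ ⁅(P : Subgroup G), (P : Subgroup G)⁆ := by
    refine le_trans ?_ (P.focalSubgroup_le_commutator_self hloc hP)
    rw [← commutator_inf_eq_focalSubgroup, htop, top_inf_eq]
  have hs : Group.IsSolvable P := P.2.isSolvable
  have hn : Nontrivial P := (nontrivial_iff_ne_bot _).2 hP
  refine (Group.IsSolvable.commutator_lt_top_of_nontrivial P).not_ge fun x _ => ?_
  rw [← mem_map_iff_mem (P : Subgroup G).subtype_injective, map_subtype_commutator]
  exact h1 x.2

end Sylow

theorem isSolvable_of_isSupersolvable_maximal {G : Type*} [Group G] [Finite G]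
    (h : ∀ M : Subgroup G, IsCoatom M → IsSupersolvable M) : Group.IsSolvable G := by
  induction hn : Nat.card G using Nat.strong_induction_on generalizing G with | _ n ih
  subst hn
  rcases subsingleton_or_nontrivial G with hG | hG
  · infer_instance
  by_cases hN : ∃ N : Subgroup G, N.Normal ∧ N ≠ ⊥ ∧ N ≠ ⊤
  · obtain ⟨N, hN, hb, ht⟩ := hN
    obtain ⟨M, hM, hNM⟩ := (eq_top_or_exists_le_coatom N).resolve_left ht
    have := (h M hM).isSolvable
    refine isSolvable_of_normal_of_quotient N
      (Group.isSolvable_of_isSolvable_injective (inclusion_injective hNM))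
      (ih _ ?_ (fun L hL => ?_) rfl)
    · rw [card_eq_card_quotient_mul_card_subgroup N]
      exact lt_mul_of_one_lt_right Nat.card_pos ((one_lt_card_iff_ne_bot N).2 hb)
    · have hs := QuotientGroup.mk'_surjective N
      exact (h _ (isCoatom_comap_of_surjective hs hL)).of_surjective
        (MonoidHom.subgroupComap_surjective_of_surjective _ L hs)
  push Not at hN
  by_contra hns
  have hcard : Nat.card G ≠ 1 := Finite.one_lt_card.ne'
  set p := (Nat.card G).minFac with hp
  have hpp : p.Prime := Nat.minFac_prime hcard
  have : Fact p.Prime := ⟨hpp⟩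
  have hloc (D : Subgroup G) (hD : IsPGroup p D) (hb : D ≠ ⊥) :
      IsPNilpotent p (normalizer (D : Set G)) := by
    by_cases ht : normalizer (D : Set G) = ⊤
    · have hDt := hN D (normalizer_eq_top_iff.1 ht) hb
      exact absurd (IsPGroup.isSolvable (hD.of_equiv (hDt ▸ topEquiv))) hns
    · obtain ⟨M, hM, hle⟩ := (eq_top_or_exists_le_coatom _).resolve_left ht
      exact ((h M hM).isPNilpotent hpp fun q hq hd =>
        Nat.minFac_le_of_dvd hq.two_le (hd.trans (card_subgroup_dvd_card M))).mono hle
  let P : Sylow p G := default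
  have hc := P.commutator_ne_top_of_isPNilpotent_normalizer hloc
    (P.ne_bot_of_dvd_card (Nat.minFac_dvd _))
  have hcb : commutator G = ⊥ := by
    by_contra hb
    exact hc (hN _ inferInstance hb)
  refine hns ((Group.isSolvable_def G).2 ⟨1, ?_⟩)
  rwa [derivedSeries_one]

theorem exists_both_kinds_of_maximal (G : Type*) [Group G] [Finite G]
    (h : ∀ M : Subgroup G, IsCoatom M → IsSupersolvable M ∨
      ∃ q : ℕ, q.Prime ∧ (M.index = q ∨ M.index = q ^ 2))
    (hG : ¬ IsSolvable G) :
    (∃ M : Subgroup G, IsCoatom M ∧ ∃ q : ℕ, q.Prime ∧ (M.index = q ∨ M.index = q ^ 2)) ∧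
    (∃ M : Subgroup G, IsCoatom M ∧ IsSupersolvable M) := by
  constructor
  · by_contra hc
    push Not at hc
    refine hG (isSolvable_of_isSupersolvable_maximal fun M hM => (h M hM).resolve_right ?_)
    rintro ⟨q, hq, hi | hi⟩
    exacts [(hc M hM q hq).1 hi, (hc M hM q hq).2 hi]
  · by_contra hc
    push Not at hc
    exact hG (isSolvable_of_index_prime_or_sq fun M hM => (h M hM).resolve_left (hc M hM))
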